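/- Let F be a field of characteristic p > 0 with #F ≥ n, and n ≥ 2. The number of distinct k-nuclei of the normal rational curve V_1^n, as k ranges over {−1, 0, ..., n−1}, equals the number of non-zero digits in the base-p representation of n+1. -/

import Mathlib

/-- The `k`-osculating subspace (here parametrized by `c = k+1`, the number of spanning
columns) of the normal rational curve `x ↦ (1, x, …, xⁿ)` in `F^{n+1}` at the point with
parameter `u`: the span of the first `c` columns of the matrix with entries
`C(r,s) u^{r−s}` (`0 ≤ s ≤ r ≤ n`), i.e. of the point and its first `c-1`
Hasse-derivative points. -/
def oscSub (F : Type) [Field F] (n : ℕ) (u : F) (c : ℕ) : Submodule F (Fin (n + 1) → F) :=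
  Submodule.span F
    (Set.range fun s : Fin c => fun r : Fin (n + 1) => (r.1.choose s.1 : F) * u ^ (r.1 - s.1))

/-- The `k`-osculating subspace (with `c = k+1`) at the point `u = ∞` of the curve:
the span of the last `c` standard basis vectors `e_n, …, e_{n-c+1}`. -/
def oscInfty (F : Type) [Field F] (n c : ℕ) : Submodule F (Fin (n + 1) → F) :=
  Submodule.span F {v | ∃ i : Fin (n + 1), n + 1 ≤ i.1 + c ∧ v = Pi.single i 1}

/-- The `k`-nucleus (with `c = k+1`) of the normal rational curve: the intersection of
all its `k`-osculating subspaces. -/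
def nucleus (F : Type) [Field F] (n c : ℕ) : Submodule F (Fin (n + 1) → F) :=
  (⨅ u : F, oscSub F n u c) ⊓ oscInfty F n c

/-- The σ-th digit of `x` in base `p`. -/
def digit (p x σ : ℕ) : ℕ := x / p ^ σ % p

/-- Lucas' theorem, splitting off all digits below a power of `p` at once. -/
theorem choose_modEq_choose_mod_pow_mul_choose_div_pow {p : ℕ} (hp : p.Prime) (R m j : ℕ) :
    m.choose j ≡ (m % p ^ R).choose (j % p ^ R) * (m / p ^ R).choose (j / p ^ R) [MOD p] := by
  have : Fact p.Prime := ⟨hp⟩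
  induction R generalizing m j with
  | zero => simp [Nat.mod_one, Nat.ModEq.refl]
  | succ R ih =>
    have h1 := Choose.choose_modEq_choose_mod_mul_choose_div_nat (p := p) (n := m) (k := j)
    have h2 := ih (m / p) (j / p)
    have h3 := Choose.choose_modEq_choose_mod_mul_choose_div_nat (p := p)
      (n := m % p ^ (R + 1)) (k := j % p ^ (R + 1))
    have e : ∀ x : ℕ, x % p ^ (R + 1) % p = x % p := fun x =>
      Nat.mod_mod_of_dvd _ (dvd_pow_self p R.succ_ne_zero)
    have e' : ∀ x : ℕ, x % p ^ (R + 1) / p = x / p % p ^ R := fun x => by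
      rw [pow_succ', Nat.mod_mul_right_div_self]
    rw [e, e, e', e'] at h3
    rw [Nat.div_div_eq_div_mul, Nat.div_div_eq_div_mul, ← pow_succ'] at h2
    calc m.choose j ≡ _ [MOD p] := h1
      _ ≡ _ [MOD p] := h2.mul_left _
      _ = _ := (mul_assoc _ _ _).symm
      _ ≡ _ [MOD p] := (h3.symm.mul_right _)

/-- If `d` is a non-zero truncation of `b` in base `p`, then `p` divides all binomial
coefficients `C(m, d - 1)` with `d ≤ m < b`. -/
theorem dvd_choose_of_succ_eq_truncation {p : ℕ} (hp : p.Prime) {b c R m : ℕ}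
    (hc : c + 1 = b / p ^ R * p ^ R) (hcm : c < m) (hmb : m < b) : p ∣ m.choose c := by
  have hq : 0 < p ^ R := pow_pos hp.pos R
  have hb := Nat.div_add_mod' b (p ^ R)
  have hbq := Nat.mod_lt b hq
  have hb0 : 0 < b / p ^ R := Nat.pos_of_ne_zero fun h => by simp [h] at hc
  obtain ⟨t, ht⟩ := Nat.exists_eq_succ_of_ne_zero hb0.ne'
  rw [ht, Nat.succ_mul] at hb hc
  have hcq : c % p ^ R = p ^ R - 1 := by
    rw [show c = p ^ R - 1 + t * p ^ R by omega, Nat.add_mul_mod_self_right,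
      Nat.mod_eq_of_lt (by omega)]
  have hmq : m % p ^ R = m - (t * p ^ R + p ^ R) := by
    conv_lhs => rw [show m = m - (t * p ^ R + p ^ R) + (t + 1) * p ^ R by
      rw [Nat.succ_mul]; omega]
    rw [Nat.add_mul_mod_self_right, Nat.mod_eq_of_lt (by omega)]
  have h := choose_modEq_choose_mod_pow_mul_choose_div_pow hp R m c
  rw [Nat.choose_eq_zero_of_lt (by omega : m % p ^ R < c % p ^ R), zero_mul] at h
  exact (Nat.modEq_zero_iff_dvd).1 h

/-- If `p` divides `C(m, j)` for all `c < m < b` but not `C(c, j)`, then `c + 1` is a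
truncation of `b` in base `p`. -/
theorem exists_truncation_eq_succ {p : ℕ} (hp : p.Prime) {b c : ℕ} (hcb : c < b)
    (h : c + 1 < b → ∃ j, ¬ p ∣ c.choose j ∧ ∀ m, c < m → m < b → p ∣ m.choose j) :
    ∃ R, digit p b R ≠ 0 ∧ c + 1 = b / p ^ R * p ^ R := by
  obtain ⟨R, d, hd, hcd⟩ := Nat.exists_eq_pow_mul_and_not_dvd c.succ_ne_zero p hp.ne_one
  have hq : 0 < p ^ R := pow_pos hp.pos R
  suffices hbd : b / p ^ R = d by
    refine ⟨R, ?_, by rw [hbd, mul_comm, ← hcd]⟩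
    rw [digit, hbd]
    exact fun h0 => hd (Nat.dvd_of_mod_eq_zero h0)
  obtain ⟨t, rfl⟩ := Nat.exists_eq_succ_of_ne_zero (show d ≠ 0 by rintro rfl; simp at hd)
  have hle : t.succ ≤ b / p ^ R := (Nat.le_div_iff_mul_le hq).2 (by rw [mul_comm]; omega)
  refine le_antisymm (not_lt.1 fun hlt => ?_) hle
  have hb : p ^ R * (t + 2) ≤ b := by
    rw [mul_comm]; exact (Nat.le_div_iff_mul_le hq).1 hlt
  rw [Nat.mul_succ] at hcd
  rw [show t + 2 = t + 1 + 1 from rfl, Nat.mul_succ, Nat.mul_succ] at hb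
  obtain ⟨j, hj, hm⟩ := h (by omega)
  have hm := hm (c + p ^ R) (by omega) (by omega)
  have hc : c = p ^ R - 1 + p ^ R * t := by omega
  have l1 := choose_modEq_choose_mod_pow_mul_choose_div_pow hp R c j
  have l2 := choose_modEq_choose_mod_pow_mul_choose_div_pow hp R (c + p ^ R) j
  have hcd' : c / p ^ R = t := by
    rw [hc, Nat.add_mul_div_left _ _ hq, Nat.div_eq_of_lt (by omega), zero_add]
  rw [Nat.add_mod_right, Nat.add_div_right _ hq, hcd'] at l2
  rw [hcd'] at l1
  rw [l1.dvd_iff dvd_rfl] at hj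
  rw [l2.dvd_iff dvd_rfl] at hm
  have hj1 := fun h' => hj (Dvd.dvd.mul_right h' _)
  have hj2 := fun h' => hj (Dvd.dvd.mul_left h' _)
  have hm' := (hp.dvd_mul.1 hm).resolve_left hj1
  have := Nat.choose_mul_succ_eq t (j / p ^ R)
  rcases hp.dvd_mul.1 (this ▸ Dvd.dvd.mul_right hm' _) with h' | h'
  exacts [hj2 h', hd h']

/-- The generalized Pascal matrices `(C(r, s) x ^ (r - s))` multiply by adding their parameters. -/
theorem sum_choose_mul_choose_mul_pow {F : Type*} [Field F] (x y : F) {m n : ℕ} (hm : m ≤ n)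
    (s : ℕ) :
    ∑ j : Fin (n + 1), ((m.choose j : F) * x ^ (m - j)) * ((j.1.choose s : F) * y ^ (j - s))
      = (m.choose s : F) * (x + y) ^ (m - s) := by
  rw [Fin.sum_univ_eq_sum_range (fun j : ℕ =>
    ((m.choose j : F) * x ^ (m - j)) * ((j.choose s : F) * y ^ (j - s))) (n + 1),
    ← Finset.sum_subset (Finset.range_mono (Nat.succ_le_succ hm)) fun j _ hj => by
      rw [Nat.choose_eq_zero_of_lt (by simpa using hj)]; simp]
  have h := congrArg (Polynomial.coeff · s)
    (add_pow (Polynomial.X + Polynomial.C y) (Polynomial.C x) m)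
  rw [add_assoc, ← Polynomial.C_add] at h
  simp only [Polynomial.coeff_X_add_C_pow, Polynomial.finsetSum_coeff, ← Polynomial.C_pow,
    ← Polynomial.C_eq_natCast, Polynomial.coeff_mul_C] at h
  rw [mul_comm, add_comm x, h]
  exact Finset.sum_congr rfl fun j _ => by ring

theorem mem_oscSub_iff {F : Type} [Field F] {n c : ℕ} {u : F}
    {v : Fin (n + 1) → F} :
    v ∈ oscSub F n u c ↔ ∀ m, c ≤ m → m ≤ n →
      ∑ j : Fin (n + 1), ((m.choose j : F) * (-u) ^ (m - j)) * v j = 0 := by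
  constructor
  · intro hv m hcm hmn
    induction hv using Submodule.span_induction with
    | mem x hx =>
      obtain ⟨s, rfl⟩ := hx
      rw [sum_choose_mul_choose_mul_pow _ _ hmn, neg_add_cancel, zero_pow (by omega), mul_zero]
    | zero => simp
    | add x y _ _ hx hy => simp [mul_add, Finset.sum_add_distrib, hx, hy]
    | smul a x _ hx =>
      simp only [Pi.smul_apply, smul_eq_mul, mul_left_comm _ a]
      rw [← Finset.mul_sum, hx, mul_zero]
  · intro h
    have key : v = ∑ s : Fin (n + 1),
        (∑ j : Fin (n + 1), ((s.1.choose j : F) * (-u) ^ (s.1 - j)) * v j) •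
          fun r : Fin (n + 1) => (r.1.choose s.1 : F) * u ^ (r.1 - s.1) := by
      ext r
      simp only [Finset.sum_apply, Pi.smul_apply, smul_eq_mul, Finset.sum_mul]
      rw [Finset.sum_comm]
      have (j : Fin (n + 1)) : ∑ s : Fin (n + 1), (s.1.choose j : F) * (-u) ^ (s.1 - j) * v j *
          ((r.1.choose s.1 : F) * u ^ (r.1 - s.1)) = if r = j then v j else 0 := by
        have h := sum_choose_mul_choose_mul_pow u (-u) (Nat.lt_succ_iff.1 r.2) j
        rw [add_neg_cancel] at h
        calc _ = (∑ s : Fin (n + 1), ((r.1.choose s.1 : F) * u ^ (r.1 - s.1)) *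
              ((s.1.choose j : F) * (-u) ^ (s.1 - j))) * v j := by
                rw [Finset.sum_mul]; exact Finset.sum_congr rfl fun _ _ => by ring
          _ = _ := by
            rw [h]
            split_ifs with hrj
            · simp [hrj]
            · rcases lt_or_gt_of_ne (fun h => hrj (Fin.ext h) : r.1 ≠ j.1) with hlt | hlt
              · simp [Nat.choose_eq_zero_of_lt hlt]
              · rw [zero_pow (by omega)]; simp
      simp [this]
    rw [key]
    refine Submodule.sum_mem _ fun s _ => ?_
    by_cases hs : s.1 < c
    · exact Submodule.smul_mem _ _ (Submodule.subset_span ⟨⟨s.1, hs⟩, rfl⟩)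
    · rw [h s.1 (by omega) (by omega), zero_smul]
      exact Submodule.zero_mem _

theorem mem_oscInfty_iff {F : Type} [Field F] {n c : ℕ} {v : Fin (n + 1) → F} :
    v ∈ oscInfty F n c ↔ ∀ i : Fin (n + 1), i.1 + c ≤ n → v i = 0 := by
  constructor
  · intro hv i hi
    induction hv using Submodule.span_induction with
    | mem x hx =>
      obtain ⟨k, hk, rfl⟩ := hx
      exact Pi.single_eq_of_ne (by rintro rfl; omega) _
    | zero => rfl
    | add x y _ _ hx hy => simp [hx, hy]
    | smul a x _ hx => simp [hx]
  · intro h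
    rw [pi_eq_sum_univ' v]
    refine Submodule.sum_mem _ fun i _ => ?_
    by_cases hi : i.1 + c ≤ n
    · rw [h i hi, zero_smul]
      exact Submodule.zero_mem _
    · refine Submodule.smul_mem _ _ (Submodule.subset_span ⟨i, by omega, ?_⟩)
      ext j
      simp [Pi.single_apply, eq_comm]

theorem exists_choose_ne_zero (F : Type*) [Field F] (j c : ℕ) :
    ∃ m, c ≤ m ∧ m ≤ c + j ∧ (m.choose j : F) ≠ 0 := by
  induction j with
  | zero => exact ⟨c, le_rfl, le_rfl, by simp⟩
  | succ j ih =>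
    obtain ⟨m, hcm, hmj, hm⟩ := ih
    by_contra! h
    have h1 := h m hcm (by omega)
    have h2 := h (m + 1) (by omega) (by omega)
    rw [Nat.choose_succ_succ, Nat.cast_add, h1, add_zero] at h2
    exact hm h2

/-- A vector lies in the nucleus iff it is supported on those `j` for which `C(m, j)` vanishes
in `F` for all `c ≤ m ≤ n`. -/
theorem mem_nucleus_iff {F : Type} [Field F] {n c : ℕ} (hn : 0 < n)
    (hF : (n : Cardinal) ≤ Cardinal.mk F) (hc : c ≤ n) {v : Fin (n + 1) → F} :
    v ∈ nucleus F n c ↔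
      ∀ (j : Fin (n + 1)) (m : ℕ), c ≤ m → m ≤ n → (m.choose j : F) * v j = 0 := by
  simp only [nucleus, Submodule.mem_inf, Submodule.mem_iInf, mem_oscSub_iff,
    mem_oscInfty_iff]
  constructor
  · rintro ⟨h, hinf⟩ j m hcm hmn
    have hv0 : v 0 = 0 := hinf 0 (by simpa using hc)
    rcases lt_or_ge m j.1 with hjm | hjm
    · simp [Nat.choose_eq_zero_of_lt hjm]
    let Q : Polynomial F :=
      ∑ j : Fin (n + 1), Polynomial.monomial (m - j) ((m.choose j : F) * v j)
    have hdeg : Q ∈ Polynomial.degreeLT F n := by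
      refine Submodule.sum_mem _ fun i _ => ?_
      by_cases hi : i = 0
      · simp [hi, hv0]
      · rw [Polynomial.mem_degreeLT]
        refine (Polynomial.degree_monomial_le _ _).trans_lt ?_
        have : i.1 ≠ 0 := fun h => hi (Fin.ext h)
        exact_mod_cast (by omega : m - i.1 < n)
    have hcard : Cardinal.mk (Fin n) ≤ Cardinal.mk F := by simpa using hF
    obtain ⟨f⟩ := hcard
    have hQ : Q = 0 := by
      refine Polynomial.eq_zero_of_natDegree_lt_card_of_eval_eq_zero Q f.injective (fun i => ?_) ?_
      · have := h (-f i) m hcm hmn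
        rw [neg_neg] at this
        rw [← this, Polynomial.eval_finsetSum]
        exact Finset.sum_congr rfl fun j _ => by rw [Polynomial.eval_monomial]; ring
      · rw [Fintype.card_fin]
        by_cases hQ0 : Q = 0
        · simpa [hQ0] using hn
        · exact (Polynomial.natDegree_lt_iff_degree_lt hQ0).2 (Polynomial.mem_degreeLT.1 hdeg)
    have hcoeff := congrArg (Polynomial.coeff · (m - j.1)) hQ
    simp only [Q, Polynomial.finsetSum_coeff, Polynomial.coeff_monomial,
      Polynomial.coeff_zero] at hcoeff
    rw [Finset.sum_eq_single j] at hcoeff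
    · simpa using hcoeff
    · intro i _ hij
      have hij' : i.1 ≠ j.1 := fun h => hij (Fin.ext h)
      rcases lt_or_ge m i.1 with him | him
      · simp [Nat.choose_eq_zero_of_lt him]
      · rw [if_neg (by omega)]
    · simp
  · intro h
    refine ⟨fun u m hcm hmn => Finset.sum_eq_zero fun j _ => ?_, fun i hi => ?_⟩
    · rw [mul_right_comm, h j m hcm hmn, zero_mul]
    · obtain ⟨m, hcm, hmi, hm⟩ := exists_choose_ne_zero F i.1 c
      exact (mul_eq_zero.1 (h i m hcm (by omega))).resolve_left hm

theorem nucleus_mono {F : Type} [Field F] {n c d : ℕ} (hn : 0 < n)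
    (hF : (n : Cardinal) ≤ Cardinal.mk F) (hcd : c ≤ d) (hd : d ≤ n) :
    nucleus F n c ≤ nucleus F n d := fun _ hv =>
  (mem_nucleus_iff hn hF hd).2 fun j m hm =>
    (mem_nucleus_iff hn hF (hcd.trans hd)).1 hv j m (hcd.trans hm)

theorem not_nucleus_succ_le_of_truncation {F : Type} [Field F] {p : ℕ} (hp : p.Prime) [CharP F p]
    {n c R : ℕ} (hF : (n : Cardinal) ≤ Cardinal.mk F) (hc : c < n)
    (hR : c + 1 = (n + 1) / p ^ R * p ^ R) : ¬ nucleus F n (c + 1) ≤ nucleus F n c := by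
  have hn : 0 < n := by omega
  intro h
  have hv : (Pi.single ⟨c, by omega⟩ 1 : Fin (n + 1) → F) ∈ nucleus F n (c + 1) := by
    refine (mem_nucleus_iff hn hF hc).2 fun j m hcm hmn => ?_
    by_cases hj : j = ⟨c, by omega⟩
    · subst hj
      rw [(CharP.cast_eq_zero_iff F p _).2
        (dvd_choose_of_succ_eq_truncation hp hR hcm (by omega)), zero_mul]
    · simp [hj]
  have := (mem_nucleus_iff hn hF hc.le).1 (h hv) ⟨c, by omega⟩ c le_rfl hc.le
  simp at this

theorem exists_truncation_of_nucleus_ne {F : Type} [Field F] {p : ℕ} (hp : p.Prime) [CharP F p]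
    {n c : ℕ} (hF : (n : Cardinal) ≤ Cardinal.mk F) (hc : c ≤ n)
    (hne : c < n → nucleus F n c ≠ nucleus F n (c + 1)) :
    ∃ R, digit p (n + 1) R ≠ 0 ∧ c + 1 = (n + 1) / p ^ R * p ^ R := by
  refine exists_truncation_eq_succ hp (by omega) fun hcn => ?_
  have hn : 0 < n := by omega
  have hcn : c < n := by omega
  by_contra! h
  refine hne hcn (le_antisymm (nucleus_mono hn hF c.le_succ hcn) fun v hv => ?_)
  rw [mem_nucleus_iff hn hF hcn] at hv
  refine (mem_nucleus_iff hn hF hc).2 fun j m hcm hmn => ?_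
  rcases hcm.eq_or_lt with rfl | hcm
  · by_cases hj : p ∣ c.choose j
    · rw [(CharP.cast_eq_zero_iff F p _).2 hj, zero_mul]
    · obtain ⟨m, hcm, hmn, hm⟩ := h j hj
      rw [(mul_eq_zero.1 (hv j m hcm (by omega))).resolve_left
        (fun h0 => hm ((CharP.cast_eq_zero_iff F p _).1 h0)), mul_zero]
  · exact hv j m hcm hmn

theorem exists_nucleus_eq_truncation {F : Type} [Field F] {p : ℕ} (hp : p.Prime) [CharP F p]
    {n c : ℕ} (hF : (n : Cardinal) ≤ Cardinal.mk F) (hc : c ≤ n) :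
    ∃ R, digit p (n + 1) R ≠ 0 ∧
      nucleus F n ((n + 1) / p ^ R * p ^ R - 1) = nucleus F n c := by
  induction hc using Nat.decreasingInduction with
  | self =>
    obtain ⟨R, hR, h⟩ := exists_truncation_of_nucleus_ne (F := F) hp hF le_rfl
      fun h => absurd h (lt_irrefl n)
    exact ⟨R, hR, by rw [← h, Nat.add_sub_cancel]⟩
  | of_succ c hc ih =>
    by_cases heq : nucleus F n c = nucleus F n (c + 1)
    · rwa [heq]
    · obtain ⟨R, hR, h⟩ := exists_truncation_of_nucleus_ne (F := F) hp hF (le_of_lt hc) fun _ => heq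
      exact ⟨R, hR, by rw [← h, Nat.add_sub_cancel]⟩

theorem pow_le_of_digit_ne_zero {p x σ : ℕ} (h : digit p x σ ≠ 0) : p ^ σ ≤ x := by
  by_contra! hlt
  simp [digit, Nat.div_eq_of_lt hlt] at h

theorem truncation_pos {p x σ : ℕ} (hp : 0 < p) (h : digit p x σ ≠ 0) :
    0 < x / p ^ σ * p ^ σ :=
  Nat.mul_pos (Nat.div_pos (pow_le_of_digit_ne_zero h) (pow_pos hp σ)) (pow_pos hp σ)

theorem truncation_lt_of_lt {p x σ τ : ℕ} (hp : 0 < p) (h : digit p x σ ≠ 0) (hστ : σ < τ) :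
    x / p ^ τ * p ^ τ < x / p ^ σ * p ^ σ := by
  obtain ⟨k, rfl⟩ := Nat.exists_eq_add_of_lt hστ
  have e : p ^ (σ + k + 1) = p ^ σ * (p * p ^ k) := by ring
  rw [e, ← Nat.div_div_eq_div_mul, ← Nat.div_div_eq_div_mul]
  have h1 := Nat.div_mul_le_self (x / p ^ σ / p) (p ^ k)
  have h2 := Nat.div_add_mod (x / p ^ σ) p
  have h3 : 0 < x / p ^ σ % p := Nat.pos_of_ne_zero h
  calc _ = p * (x / p ^ σ / p / p ^ k * p ^ k) * p ^ σ := by ring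
    _ ≤ p * (x / p ^ σ / p) * p ^ σ := by gcongr
    _ < _ := Nat.mul_lt_mul_of_pos_right (by omega) (pow_pos hp σ)

/-- Over a field of characteristic `p > 0` with `#F ≥ n`, the number of distinct
`k`-nuclei of the normal rational curve `V_1^n`, as `k` ranges over `{−1,…,n−1}`
(i.e. `c = k+1` ranges over `{0,…,n}`), equals the number of non-zero digits in the
base-`p` representation of `n+1`. (Digits of `n+1` with index `σ > n+1` vanish, so
it suffices to count indices `σ < n+2`.) -/
theorem card_distinct_nuclei (F : Type) [Field F] (p : ℕ) (hp : p.Prime) [CharP F p]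
    (n : ℕ) (hn : 2 ≤ n) (hF : (n : Cardinal) ≤ Cardinal.mk F) :
    {N : Submodule F (Fin (n + 1) → F) | ∃ c ≤ n, N = nucleus F n c}.ncard
      = ((Finset.range (n + 2)).filter fun σ => digit p (n + 1) σ ≠ 0).card := by
  have hn0 : 0 < n := by omega
  have hne : ∀ σ τ, σ < τ → digit p (n + 1) σ ≠ 0 → digit p (n + 1) τ ≠ 0 →
      nucleus F n ((n + 1) / p ^ σ * p ^ σ - 1) ≠ nucleus F n ((n + 1) / p ^ τ * p ^ τ - 1) := by
    intro σ τ hlt hσ hτ heq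
    have hpos := truncation_pos hp.pos hτ
    have hT := truncation_lt_of_lt hp.pos hσ hlt
    have hle := Nat.div_mul_le_self (n + 1) (p ^ σ)
    refine not_nucleus_succ_le_of_truncation (F := F) (c := (n + 1) / p ^ τ * p ^ τ - 1) hp hF
      (by omega) (Nat.sub_add_cancel hpos) ?_
    rw [← heq]
    exact nucleus_mono hn0 hF (by omega) (by omega)
  rw [← Finset.card_image_of_injOn
    (f := fun σ => nucleus F n ((n + 1) / p ^ σ * p ^ σ - 1)), ← Set.ncard_coe_finset]
  · congr 1
    ext N
    simp only [Set.mem_ofPred_eq, Finset.coe_image, Finset.coe_filter, Finset.mem_range,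
      Set.mem_image]
    constructor
    · rintro ⟨c, hc, rfl⟩
      obtain ⟨R, hR, h⟩ := exists_nucleus_eq_truncation hp hF hc
      refine ⟨R, ⟨?_, hR⟩, h⟩
      have := pow_le_of_digit_ne_zero hR
      have := Nat.lt_pow_self (n := R) hp.one_lt
      omega
    · rintro ⟨σ, -, rfl⟩
      have hle := Nat.div_mul_le_self (n + 1) (p ^ σ)
      exact ⟨_, by omega, rfl⟩
  · intro σ hσ τ hτ heq
    simp only [Finset.coe_filter, Set.mem_ofPred_eq] at hσ hτ
    rcases lt_trichotomy σ τ with hlt | rfl | hlt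
    · exact absurd heq (hne σ τ hlt hσ.2 hτ.2)
    · rfl
    · exact absurd heq.symm (hne τ σ hlt hτ.2 hσ.2)
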